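/- arXiv:1606.01712 — 10 statements merged into one kernel-verified Lean document; each statement's English description precedes it below -/
import Mathlib

section
/- Let k be a field, g a Lie algebra over k, R : g → g a k-linear map, and ε ∈ k a scalar such that ⁅R X, R Y⁆ − R(⁅R X, Y⁆ + ⁅X, R Y⁆) = ε • ⁅X, Y⁆ for all X, Y ∈ g. Then for any scalar γ ∈ k the bracket ⁅X, Y⁆_R := γ • (⁅R X, Y⁆ + ⁅X, R Y⁆) is k-bilinear, alternating, and satisfies the Jacobi identity; hence it makes the underlying k-module of g into a Lie algebra, denoted g_R. -/
/-- The `R`-bracket `⁅X, Y⁆_R := γ • (⁅R X, Y⁆ + ⁅X, R Y⁆)`. -/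
def rBracket {k g : Type*} [Field k] [LieRing g] [LieAlgebra k g]
    (R : g →ₗ[k] g) (γ : k) (X Y : g) : g :=
  γ • (⁅R X, Y⁆ + ⁅X, R Y⁆)

/-- If `R` satisfies `⁅R X, R Y⁆ − R(⁅R X, Y⁆ + ⁅X, R Y⁆) = ε • ⁅X, Y⁆` then for any `γ`
the `R`-bracket is `k`-bilinear, alternating, and satisfies the Jacobi identity; hence it
endows the underlying `k`-module of `g` with a Lie algebra structure `g_R`. -/
theorem rBracket_isLieBracket {k g : Type*} [Field k] [LieRing g] [LieAlgebra k g]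
    (R : g →ₗ[k] g) (ε : k)
    (hR : ∀ X Y : g, ⁅R X, R Y⁆ - R (⁅R X, Y⁆ + ⁅X, R Y⁆) = ε • ⁅X, Y⁆)
    (γ : k) :
    (∀ (a : k) (X Y Z : g),
      rBracket R γ (a • X + Y) Z = a • rBracket R γ X Z + rBracket R γ Y Z) ∧
    (∀ (a : k) (X Y Z : g),
      rBracket R γ X (a • Y + Z) = a • rBracket R γ X Y + rBracket R γ X Z) ∧
    (∀ X : g, rBracket R γ X X = 0) ∧
    (∀ X Y Z : g,
      rBracket R γ X (rBracket R γ Y Z) + rBracket R γ Y (rBracket R γ Z X)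
        + rBracket R γ Z (rBracket R γ X Y) = 0) := by
  refine ⟨?_, ?_, ?_, ?_⟩
  · intro a X Y Z
    simp only [rBracket, map_add, map_smul, add_lie, smul_lie, smul_add, smul_comm γ a]
    abel
  · intro a X Y Z
    simp only [rBracket, map_add, map_smul, lie_add, lie_smul, smul_add, smul_comm γ a]
    abel
  · intro X
    rw [rBracket, ← lie_skew X (R X), add_neg_cancel, smul_zero]
  · intro X Y Z
    have key : ∀ A B C : g, rBracket R γ A (rBracket R γ B C) =
        γ • γ • (⁅R A, ⁅R B, C⁆⁆ + ⁅R A, ⁅B, R C⁆⁆ + ⁅A, ⁅R B, R C⁆⁆ - ε • ⁅A, ⁅B, C⁆⁆) := by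
      intro A B C
      have h : R (⁅R B, C⁆ + ⁅B, R C⁆) = ⁅R B, R C⁆ - ε • ⁅B, C⁆ := by
        rw [← hR B C]; abel
      simp only [rBracket]
      rw [map_smul, h, lie_smul, lie_smul, ← smul_add, lie_sub, lie_smul, lie_add, add_sub_assoc]
    rw [key, key, key, ← smul_add, ← smul_add, ← smul_add, ← smul_add]
    have e : ⁅R X, ⁅R Y, Z⁆⁆ + ⁅R X, ⁅Y, R Z⁆⁆ + ⁅X, ⁅R Y, R Z⁆⁆ - ε • ⁅X, ⁅Y, Z⁆⁆
        + (⁅R Y, ⁅R Z, X⁆⁆ + ⁅R Y, ⁅Z, R X⁆⁆ + ⁅Y, ⁅R Z, R X⁆⁆ - ε • ⁅Y, ⁅Z, X⁆⁆)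
        + (⁅R Z, ⁅R X, Y⁆⁆ + ⁅R Z, ⁅X, R Y⁆⁆ + ⁅Z, ⁅R X, R Y⁆⁆ - ε • ⁅Z, ⁅X, Y⁆⁆)
        = (⁅R X, ⁅R Y, Z⁆⁆ + ⁅R Y, ⁅Z, R X⁆⁆ + ⁅Z, ⁅R X, R Y⁆⁆)
        + (⁅R X, ⁅Y, R Z⁆⁆ + ⁅Y, ⁅R Z, R X⁆⁆ + ⁅R Z, ⁅R X, Y⁆⁆)
        + (⁅X, ⁅R Y, R Z⁆⁆ + ⁅R Y, ⁅R Z, X⁆⁆ + ⁅R Z, ⁅X, R Y⁆⁆)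
        - ε • (⁅X, ⁅Y, Z⁆⁆ + ⁅Y, ⁅Z, X⁆⁆ + ⁅Z, ⁅X, Y⁆⁆) := by
      simp only [smul_add]
      abel
    rw [e]
    simp only [lie_jacobi, smul_zero, add_zero, sub_zero]
end

section
/- Let k be a field, g a Lie algebra over k, c ∈ k, and R : g → g a k-linear map satisfying the mCYBE with constant c, i.e. ⁅R X, R Y⁆ − R(⁅R X, Y⁆ + ⁅X, R Y⁆) = −c² • ⁅X, Y⁆ for all X, Y ∈ g. Set R^± := R ± c • id. Then for all X, Y ∈ g one has ⁅R^± X, R^± Y⁆ = R^±(⁅R X, Y⁆ + ⁅X, R Y⁆). Consequently, for any scalar γ ∈ k the maps γ • R^± : g_R → g are Lie algebra homomorphisms from g_R (the underlying module of g with bracket ⁅X, Y⁆_R = γ • (⁅R X, Y⁆ + ⁅X, R Y⁆)) to g. -/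
/-- If `R` satisfies the mCYBE with constant `c`, then with `R^± := R ± c • id` one has
`⁅R^± X, R^± Y⁆ = R^±(⁅R X, Y⁆ + ⁅X, R Y⁆)`; consequently, for any `γ` the maps
`γ • R^±` are Lie algebra homomorphisms from `g_R` (bracket `⁅X,Y⁆_R = γ • (⁅R X, Y⁆ + ⁅X, R Y⁆)`)
to `g`. -/
theorem rpm_homomorphism {k g : Type*} [Field k] [LieRing g] [LieAlgebra k g]
    (R : g →ₗ[k] g) (c : k)
    (hR : ∀ X Y : g, ⁅R X, R Y⁆ - R (⁅R X, Y⁆ + ⁅X, R Y⁆) = (-(c ^ 2)) • ⁅X, Y⁆) :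
    (∀ X Y : g,
      ⁅R X + c • X, R Y + c • Y⁆
        = R (⁅R X, Y⁆ + ⁅X, R Y⁆) + c • (⁅R X, Y⁆ + ⁅X, R Y⁆)) ∧
    (∀ X Y : g,
      ⁅R X - c • X, R Y - c • Y⁆
        = R (⁅R X, Y⁆ + ⁅X, R Y⁆) - c • (⁅R X, Y⁆ + ⁅X, R Y⁆)) ∧
    (∀ (γ : k) (X Y : g),
      γ • (R (γ • (⁅R X, Y⁆ + ⁅X, R Y⁆)) + c • (γ • (⁅R X, Y⁆ + ⁅X, R Y⁆)))
        = ⁅γ • (R X + c • X), γ • (R Y + c • Y)⁆) ∧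
    (∀ (γ : k) (X Y : g),
      γ • (R (γ • (⁅R X, Y⁆ + ⁅X, R Y⁆)) - c • (γ • (⁅R X, Y⁆ + ⁅X, R Y⁆)))
        = ⁅γ • (R X - c • X), γ • (R Y - c • Y)⁆) := by
  have h1 : ∀ X Y : g, R (⁅R X, Y⁆ + ⁅X, R Y⁆) = ⁅R X, R Y⁆ + (c ^ 2) • ⁅X, Y⁆ := by
    intro X Y
    have h := hR X Y
    rw [neg_smul, sub_eq_iff_eq_add] at h
    rw [h]
    abel
  have hp : ∀ X Y : g,
      ⁅R X + c • X, R Y + c • Y⁆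
        = R (⁅R X, Y⁆ + ⁅X, R Y⁆) + c • (⁅R X, Y⁆ + ⁅X, R Y⁆) := by
    intro X Y
    rw [h1]
    simp only [add_lie, lie_add, smul_lie, lie_smul]
    module
  have hm : ∀ X Y : g,
      ⁅R X - c • X, R Y - c • Y⁆
        = R (⁅R X, Y⁆ + ⁅X, R Y⁆) - c • (⁅R X, Y⁆ + ⁅X, R Y⁆) := by
    intro X Y
    rw [h1]
    simp only [sub_lie, lie_sub, smul_lie, lie_smul]
    module
  refine ⟨hp, hm, ?_, ?_⟩
  · intro γ X Y
    rw [smul_lie, lie_smul, hp, map_smul]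
    module
  · intro γ X Y
    rw [smul_lie, lie_smul, hm, map_smul]
    module
end

section
/- (Drinfel'd double, Theorem 2.1.) Let k be a field, g a finite-dimensional Lie algebra over k, and suppose the dual space g* is equipped with a Lie bracket [·,·]_* satisfying the 1-cocycle compatibility condition: for all X, Y ∈ g and all λ, μ ∈ g*, [λ, μ]_*(⁅X, Y⁆) = [λ∘ad_X, μ]_*(Y) + [λ, μ∘ad_X]_*(Y) − [λ∘ad_Y, μ]_*(X) − [λ, μ∘ad_Y]_*(X), where (λ∘ad_X)(Z) := λ(⁅X, Z⁆). Then there exists a unique Lie algebra structure [·,·]_D on the direct sum D := g × g* such that the canonical inclusions ι : g → D, X ↦ (X, 0), and ι* : g* → D, λ ↦ (0, λ), are Lie algebra homomorphisms, and such that the bilinear form ⟨(X,λ)|(Y,μ)⟩ := μ(X) + λ(Y) is ad-invariant, i.e. ⟨[d₁, d₂]_D | d₃⟩ + ⟨d₂ | [d₁, d₃]_D⟩ = 0 for all d₁, d₂, d₃ ∈ D. -/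
open Module

/-- (Drinfel'd double.) Given a finite-dimensional Lie algebra `g` and a Lie bracket
`bstar` on the dual `g*` satisfying the 1-cocycle compatibility condition, there is a
unique Lie algebra structure on `D = g × g*` such that the canonical inclusions of `g`
and `g*` are Lie algebra homomorphisms and the canonical pairing
`⟨(X,λ)|(Y,μ)⟩ = μ X + λ Y` is ad-invariant. -/
theorem drinfeld_double_exists_unique {k g : Type*} [Field k] [LieRing g] [LieAlgebra k g]
    [FiniteDimensional k g]
    (bstar : Dual k g → Dual k g → Dual k g)
    (hb₁ : ∀ (a : k) (l m n : Dual k g), bstar (a • l + m) n = a • bstar l n + bstar m n)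
    (hb₂ : ∀ (a : k) (l m n : Dual k g), bstar l (a • m + n) = a • bstar l m + bstar l n)
    (halt : ∀ l : Dual k g, bstar l l = 0)
    (hjac : ∀ l m n : Dual k g,
      bstar l (bstar m n) + bstar m (bstar n l) + bstar n (bstar l m) = 0)
    (hcocycle : ∀ (X Y : g) (l m : Dual k g),
      bstar l m ⁅X, Y⁆
        = bstar (l ∘ₗ (LieAlgebra.ad k g X : g →ₗ[k] g)) m Y
          + bstar l (m ∘ₗ (LieAlgebra.ad k g X : g →ₗ[k] g)) Y
          - bstar (l ∘ₗ (LieAlgebra.ad k g Y : g →ₗ[k] g)) m X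
          - bstar l (m ∘ₗ (LieAlgebra.ad k g Y : g →ₗ[k] g)) X) :
    ∃! B : (g × Dual k g) → (g × Dual k g) → (g × Dual k g),
      (∀ (a : k) (x y z : g × Dual k g), B (a • x + y) z = a • B x z + B y z) ∧
      (∀ (a : k) (x y z : g × Dual k g), B x (a • y + z) = a • B x y + B x z) ∧
      (∀ x : g × Dual k g, B x x = 0) ∧
      (∀ x y z : g × Dual k g, B x (B y z) + B y (B z x) + B z (B x y) = 0) ∧
      (∀ X Y : g, B (X, 0) (Y, 0) = (⁅X, Y⁆, (0 : Dual k g))) ∧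
      (∀ l m : Dual k g, B (0, l) (0, m) = ((0 : g), bstar l m)) ∧
      (∀ d₁ d₂ d₃ : g × Dual k g,
        (d₃.2 (B d₁ d₂).1 + (B d₁ d₂).2 d₃.1) + ((B d₁ d₃).2 d₂.1 + d₂.2 (B d₁ d₃).1) = 0) := by
  classical
  obtain ⟨bs, hbs⟩ : ∃ bs : Dual k g →ₗ[k] Dual k g →ₗ[k] Dual k g, ∀ l m, bstar l m = bs l m := by
    have hz1 : ∀ n, bstar 0 n = 0 := fun n => by
      have := hb₁ 1 0 0 n
      simpa using this
    have hz2 : ∀ n, bstar n 0 = 0 := fun n => by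
      have := hb₂ 1 n 0 0
      simpa using this
    refine ⟨LinearMap.mk₂ k bstar ?_ ?_ ?_ ?_, fun _ _ => rfl⟩
    · intro l m n; simpa using hb₁ 1 l m n
    · intro a l n; simpa [hz1] using hb₁ a l 0 n
    · intro l m n; simpa using hb₂ 1 l m n
    · intro a l n; simpa [hz2] using hb₂ a l n 0
  simp only [hbs] at halt hjac hcocycle ⊢
  clear hb₁ hb₂
  have hanti : ∀ l m, bs l m = - bs m l := by
    intro l m
    have h := halt (l + m)
    simp only [map_add, LinearMap.add_apply, halt, zero_add, add_zero] at h
    exact eq_neg_of_add_eq_zero_right h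
  obtain ⟨co, hco⟩ : ∃ co : Dual k g → g →ₗ[k] g, (∀ l X n, n (co l X) = - bs l n X) := by
    refine ⟨fun l => (evalEquiv k g).symm.toLinearMap ∘ₗ
      (-((bs l).dualMap ∘ₗ Dual.eval k g)), ?_⟩
    intro l X n
    simp
  have hsep : ∀ x y : g, (∀ n : Dual k g, n x = n y) → x = y := by
    intro x y h
    rw [← sub_eq_zero, ← Module.forall_dual_apply_eq_zero_iff k]
    intro n
    simp [h n]
  have hext : ∀ x y : g × Dual k g, (∀ n : Dual k g, n x.1 = n y.1) →
      (∀ W, x.2 W = y.2 W) → x = y := by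
    intro x y h1 h2
    exact Prod.ext (hsep _ _ h1) (LinearMap.ext h2)
  obtain ⟨A, hA⟩ : ∃ A : g → Dual k g → Dual k g, ∀ X l, A X l = l ∘ₗ (LieAlgebra.ad k g X : g →ₗ[k] g) :=
    ⟨_, fun _ _ => rfl⟩
  have hAa : ∀ X l Y, A X l Y = l ⁅X, Y⁆ := by intro X l Y; simp [hA]
  simp only [← hA] at hcocycle
  obtain ⟨B, hB1, hB2⟩ : ∃ B : (g × Dual k g) → (g × Dual k g) → (g × Dual k g),
      (∀ x y (n : Dual k g), n (B x y).1 = n ⁅x.1, y.1⁆ - bs x.2 n y.1 + bs y.2 n x.1) ∧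
      (∀ x y, (B x y).2 = bs x.2 y.2 - A x.1 y.2 + A y.1 x.2) := by
    refine ⟨fun x y => (⁅x.1, y.1⁆ + co x.2 y.1 - co y.2 x.1,
      bs x.2 y.2 - A x.1 y.2 + A y.1 x.2), ?_, fun _ _ => rfl⟩
    intro x y n
    simp only [map_add, map_sub, hco]
    ring
  have hA2 : ∀ (X : g) (l : Dual k g) (Y : g), l ⁅Y, X⁆ = - l ⁅X, Y⁆ := by
    intro X l Y; rw [← lie_skew, map_neg]
  refine ⟨B, ⟨?_, ?_, ?_, ?_, ?_, ?_, ?_⟩, ?_⟩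
  · intro a x y z
    apply hext
    · intro n
      simp [hB1]; ring
    · intro W
      simp [hB2, hAa]; ring
  · intro a x y z
    apply hext
    · intro n
      simp [hB1]; ring
    · intro W
      simp [hB2, hAa]; ring
  · intro x
    apply hext
    · intro n
      simp [hB1]
    · intro W
      simp [hB2, halt]
  · rintro ⟨X, l⟩ ⟨Y, m⟩ ⟨Z, p⟩
    apply hext
    · intro n
      have e : ∀ (n : Dual k g) X x y, n ⁅X, (B x y).1⁆ = A X n (B x y).1 := by
        intros; rw [hAa]
      have j := congrArg n (lie_jacobi X Y Z)
      have c1 := hcocycle Y Z l n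
      have c2 := hcocycle Z X m n
      have c3 := hcocycle X Y p n
      have an : ∀ l m n W, bs (bs l m) n W = - bs n (bs l m) W := by
        intro l m n W; rw [hanti]; rfl
      have an2 : ∀ l m n W, bs n (bs l m) W = - bs n (bs m l) W := by
        intro l m n W; rw [hanti l m]; simp
      have jj : ∀ l m n W, bs l (bs m n) W + bs m (bs n l) W + bs n (bs l m) W = 0 := by
        intro l m n W; simpa using LinearMap.congr_fun (hjac l m n) W
      simp only [Prod.fst_add, map_add, map_zero, Prod.fst_zero] at j ⊢
      simp only [hB1, e, hB2, map_add, map_sub, LinearMap.add_apply, LinearMap.sub_apply, an]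
      simp only [hAa]
      linear_combination j - c1 - c2 - c3 - jj m p n X - jj p l n Y - jj l m n Z
        + an2 l n m Z + an2 m n p X + an2 p n l Y
    · intro W
      have e : ∀ (n : Dual k g) x y, A (B x y).1 n W = - A W n (B x y).1 := by
        intros; rw [hAa, hAa, hA2]
      have jj : bs l (bs m p) W + bs m (bs p l) W + bs p (bs l m) W = 0 := by
        simpa using LinearMap.congr_fun (hjac l m p) W
      have c1 := hcocycle X W m p
      have c2 := hcocycle Y W p l
      have c3 := hcocycle Z W l m
      have an : ∀ U l n V, bs (A U l) n V = - bs n (A U l) V := by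
        intro U l n V; rw [hanti]; rfl
      have jl : ∀ (l : Dual k g) (Y Z : g), l ⁅W, ⁅Y, Z⁆⁆ - l ⁅Z, ⁅Y, W⁆⁆ + l ⁅Y, ⁅Z, W⁆⁆ = 0 := by
        intro l Y Z
        have := congrArg l (lie_jacobi W Y Z)
        rw [← lie_skew W Y, lie_neg] at this
        simp only [map_add, map_neg, map_zero] at this ⊢
        linear_combination this
      simp only [an] at c1 c2 c3
      simp only [Prod.snd_add, LinearMap.add_apply, LinearMap.zero_apply, Prod.snd_zero] at ⊢
      simp only [hB1, e, hB2, map_add, map_sub, LinearMap.add_apply, LinearMap.sub_apply]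
      simp only [hAa, LinearMap.add_apply, LinearMap.sub_apply]
      linear_combination jj - c1 - c2 - c3 - jl l Y Z - jl m Z X - jl p X Y
  · intro X Y
    apply hext
    · intro n
      simp [hB1]
    · intro W
      simp [hB2, hAa]
  · intro l m
    apply hext
    · intro n
      simp [hB1]
    · intro W
      simp [hB2, hAa]
  · rintro ⟨X, l⟩ ⟨Y, m⟩ ⟨Z, p⟩
    simp only [hB1, hB2, LinearMap.add_apply, LinearMap.sub_apply, hAa]
    have h1 := LinearMap.congr_fun (hanti m p) X
    simp only [LinearMap.neg_apply] at h1
    linear_combination h1 + hA2 Y l Z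
  · rintro B' ⟨h1, h2, h3, -, h5, h6, h7⟩
    have ha1 : ∀ x y z, B' (x + y) z = B' x z + B' y z := by
      intro x y z; simpa using h1 1 x y z
    have ha2 : ∀ x y z, B' x (y + z) = B' x y + B' x z := by
      intro x y z; simpa using h2 1 x y z
    have hanti' : ∀ x y, B' x y = - B' y x := by
      intro x y
      have h := h3 (x + y)
      simp only [ha1, ha2, h3, zero_add, add_zero] at h
      exact eq_neg_of_add_eq_zero_left h
    have u1 : ∀ X (m n : Dual k g), n (B' (0, m) (X, 0)).1 = - bs m n X := by
      intro X m n
      have := h7 (0, m) (X, 0) (0, n)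
      simp only [h6] at this
      simp at this
      linear_combination this
    have u2 : ∀ X (m : Dual k g) W, (B' (X, 0) (0, m)).2 W = - m ⁅X, W⁆ := by
      intro X m W
      have := h7 (X, 0) (0, m) (W, 0)
      simp only [h5] at this
      simp at this
      linear_combination this
    funext x y
    obtain ⟨X, l⟩ := x
    obtain ⟨Y, m⟩ := y
    have d : B' (X, l) (Y, m) = B' (X, 0) (Y, 0) + B' (X, 0) (0, m) + B' (0, l) (Y, 0)
        + B' (0, l) (0, m) := by
      rw [show ((X, l) : g × Dual k g) = (X, 0) + (0, l) by simp,
        show ((Y, m) : g × Dual k g) = (Y, 0) + (0, m) by simp, ha1, ha2, ha2]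
      abel
    apply hext
    · intro n
      rw [d, h5, h6, hanti' (X, 0) (0, m)]
      simp only [Prod.fst_add, Prod.fst_neg, map_add, map_neg, u1, hB1, map_zero]
      ring
    · intro W
      rw [d, h5, h6, hanti' (0, l) (Y, 0)]
      simp only [Prod.snd_add, Prod.snd_neg, LinearMap.add_apply, LinearMap.neg_apply, u2, hB2,
        LinearMap.sub_apply, hAa, LinearMap.zero_apply]
      ring
end

section
/- (Adler–Kostant–Symes.) Let d be a Lie algebra over a field k and let a, b be Lie subalgebras of d such that d = a ⊕ b as k-vector spaces, with projections π_a and π_b onto a and b along this decomposition. Then R := π_a − π_b satisfies the split mCYBE on d: ⁅R X, R Y⁆ − R(⁅R X, Y⁆ + ⁅X, R Y⁆) = −⁅X, Y⁆ for all X, Y ∈ d. Moreover, if ⟨·|·⟩ is a symmetric bilinear form on d for which a and b are both isotropic (⟨a₁|a₂⟩ = 0 for a₁, a₂ ∈ a and ⟨b₁|b₂⟩ = 0 for b₁, b₂ ∈ b), then R is skew-symmetric with respect to ⟨·|·⟩: ⟨R X | Y⟩ = −⟨X | R Y⟩ for all X, Y ∈ d. -/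
/-- (Adler–Kostant–Symes.) If `d = a ⊕ b` is a vector space direct sum of two Lie
subalgebras, with projections `πa`, `πb` along the decomposition, then `R := πa − πb`
satisfies the split mCYBE on `d`; moreover `R` is skew-symmetric with respect to any
symmetric bilinear form for which `a` and `b` are both isotropic. -/
theorem aks_R_matrix {k d : Type*} [Field k] [LieRing d] [LieAlgebra k d]
    (a b : LieSubalgebra k d) (πa πb : d →ₗ[k] d)
    (hπa : ∀ x : d, πa x ∈ a) (hπb : ∀ x : d, πb x ∈ b)
    (hsum : ∀ x : d, πa x + πb x = x)
    (hdisj : ∀ x : d, x ∈ a → x ∈ b → x = 0) :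
    (∀ X Y : d,
      ⁅(πa - πb) X, (πa - πb) Y⁆
          - (πa - πb) (⁅(πa - πb) X, Y⁆ + ⁅X, (πa - πb) Y⁆)
        = -⁅X, Y⁆) ∧
    (∀ B : d →ₗ[k] d →ₗ[k] k,
      (∀ x y : d, B x y = B y x) →
      (∀ x ∈ a, ∀ y ∈ a, B x y = 0) →
      (∀ x ∈ b, ∀ y ∈ b, B x y = 0) →
      ∀ X Y : d, B ((πa - πb) X) Y = - B X ((πa - πb) Y)) := by
  have hRa : ∀ x ∈ a, (πa - πb) x = x := by
    intro x hx
    have h0 : πb x = 0 := by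
      refine hdisj _ ?_ (hπb x)
      have h : πb x = x - πa x := eq_sub_of_add_eq' (hsum x)
      rw [h]
      exact sub_mem hx (hπa x)
    have h := hsum x
    rw [h0, add_zero] at h
    rw [LinearMap.sub_apply, h0, h, sub_zero]
  have hRb : ∀ x ∈ b, (πa - πb) x = -x := by
    intro x hx
    have h0 : πa x = 0 := by
      refine hdisj _ (hπa x) ?_
      have h : πa x = x - πb x := eq_sub_of_add_eq (hsum x)
      rw [h]
      exact sub_mem hx (hπb x)
    have h := hsum x
    rw [h0, zero_add] at h
    rw [LinearMap.sub_apply, h0, h, zero_sub]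
  have key : ∀ x : d, ∃ p ∈ a, ∃ q ∈ b, x = p + q :=
    fun x => ⟨πa x, hπa x, πb x, hπb x, (hsum x).symm⟩
  generalize πa - πb = R at *
  refine ⟨fun X Y => ?_, fun B _ hBa hBb X Y => ?_⟩
  · obtain ⟨p, hp, q, hq, rfl⟩ := key X
    obtain ⟨r, hr, s, hs, rfl⟩ := key Y
    have e : ⁅R (p + q), r + s⁆ + ⁅p + q, R (r + s)⁆
        = (⁅p, r⁆ + ⁅p, r⁆) - (⁅q, s⁆ + ⁅q, s⁆) := by
      simp only [map_add, hRa p hp, hRa r hr, hRb q hq, hRb s hs, add_lie, lie_add,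
        neg_lie, lie_neg]
      abel
    rw [e]
    simp only [map_add, map_sub, hRa p hp, hRa r hr, hRb q hq, hRb s hs,
      hRa _ (a.lie_mem hp hr), hRb _ (b.lie_mem hq hs), add_lie, lie_add, neg_lie, lie_neg]
    abel
  · obtain ⟨p, hp, q, hq, rfl⟩ := key X
    obtain ⟨r, hr, s, hs, rfl⟩ := key Y
    simp only [map_add, map_neg, hRa p hp, hRa r hr, hRb q hq, hRb s hs,
      LinearMap.add_apply, LinearMap.neg_apply, hBa p hp r hr, hBb q hq s hs]
    ring
end

section
/- (Lemma 4.2, split case.) Let g be a Lie algebra over ℝ, γ a nonzero real number, and R : g → g a linear map satisfying the split mCYBE: ⁅R X, R Y⁆ − R(⁅R X, Y⁆ + ⁅X, R Y⁆) = −⁅X, Y⁆ for all X, Y ∈ g. Set R^± := R ± id. Then g_DR := {(R^+ X, R^- X) : X ∈ g} is a Lie subalgebra of the product Lie algebra g × g, and the map Δ : g_R → g × g, X ↦ γ • (R^+ X, R^- X), is an injective Lie algebra homomorphism from g_R (the underlying space of g with bracket ⁅X, Y⁆_R = γ(⁅R X, Y⁆ + ⁅X, R Y⁆)) onto g_DR,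 with inverse given on g_DR by (X, Y) ↦ (X − Y)/(2γ). -/
/-- (Lemma 4.2, split case.) If `R` solves the split mCYBE on a real Lie algebra `g` and
`γ ≠ 0`, then `g_DR = {(R^+ X, R^- X)}` is a Lie subalgebra of the product Lie algebra
`g × g` (bracket taken componentwise), and `Δ : X ↦ γ • (R^+ X, R^- X)` is an injective
Lie algebra homomorphism from `g_R` (bracket `⁅X,Y⁆_R = γ(⁅R X, Y⁆ + ⁅X, R Y⁆)`) onto
`g_DR`, with inverse `(X, Y) ↦ (X − Y)/(2γ)`. -/
theorem split_Delta_iso {g : Type*} [LieRing g] [LieAlgebra ℝ g]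
    (γ : ℝ) (hγ : γ ≠ 0) (R : g →ₗ[ℝ] g)
    (hR : ∀ X Y : g, ⁅R X, R Y⁆ - R (⁅R X, Y⁆ + ⁅X, R Y⁆) = -⁅X, Y⁆) :
    -- `g_DR` is closed under the componentwise bracket of `g × g`
    (∀ X Y : g, ∃ Z : g,
      ((⁅R X + X, R Y + Y⁆, ⁅R X - X, R Y - Y⁆) : g × g) = (R Z + Z, R Z - Z)) ∧
    -- `Δ` intertwines the `R`-bracket with the componentwise bracket
    (∀ X Y : g,
      γ • (((R (γ • (⁅R X, Y⁆ + ⁅X, R Y⁆)) + γ • (⁅R X, Y⁆ + ⁅X, R Y⁆),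
             R (γ • (⁅R X, Y⁆ + ⁅X, R Y⁆)) - γ • (⁅R X, Y⁆ + ⁅X, R Y⁆))) : g × g)
        = (⁅γ • (R X + X), γ • (R Y + Y)⁆, ⁅γ • (R X - X), γ • (R Y - Y)⁆)) ∧
    -- `Δ` is injective
    Function.Injective (fun X : g => γ • (((R X + X, R X - X)) : g × g)) ∧
    -- `Δ` maps onto `g_DR`
    (∀ X : g, ∃ W : g, γ • (((R X + X, R X - X)) : g × g) = (R W + W, R W - W)) ∧
    (∀ W : g, ∃ X : g, γ • (((R X + X, R X - X)) : g × g) = (R W + W, R W - W)) ∧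
    -- the inverse of `Δ` is `(X, Y) ↦ (X − Y)/(2γ)`
    (∀ X : g, (1 / (2 * γ)) • (γ • (R X + X) - γ • (R X - X)) = X) := by
  have key : ∀ X Y : g, R (⁅R X, Y⁆ + ⁅X, R Y⁆) = ⁅R X, R Y⁆ + ⁅X, Y⁆ := by
    intro X Y
    have h := hR X Y
    rw [sub_eq_iff_eq_add] at h
    rw [h]; abel
  have hp : ∀ X Y : g, ⁅R X + X, R Y + Y⁆
      = R (⁅R X, Y⁆ + ⁅X, R Y⁆) + (⁅R X, Y⁆ + ⁅X, R Y⁆) := by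
    intro X Y
    rw [key]; simp only [add_lie, lie_add]; abel
  have hm : ∀ X Y : g, ⁅R X - X, R Y - Y⁆
      = R (⁅R X, Y⁆ + ⁅X, R Y⁆) - (⁅R X, Y⁆ + ⁅X, R Y⁆) := by
    intro X Y
    rw [key]; simp only [sub_lie, lie_sub]; abel
  have inv : ∀ X : g, (1 / (2 * γ)) • (γ • (R X + X) - γ • (R X - X)) = X := by
    intro X
    have h : γ • (R X + X) - γ • (R X - X) = (2 * γ) • X := by module
    rw [h, smul_smul, one_div, inv_mul_cancel₀ (by simpa using hγ), one_smul]
  refine ⟨fun X Y => ⟨⁅R X, Y⁆ + ⁅X, R Y⁆, ?_⟩, fun X Y => ?_, fun X Y h => ?_,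
    fun X => ⟨γ • X, ?_⟩, fun W => ⟨γ⁻¹ • W, ?_⟩, inv⟩
  · rw [hp, hm]
  · simp only [smul_lie, lie_smul, hp, hm, map_smul, Prod.smul_mk]
    simp only [smul_add, smul_sub]
  · simp only [Prod.smul_mk, Prod.mk.injEq] at h
    rw [← inv X, ← inv Y, h.1, h.2]
  · simp only [map_smul, Prod.smul_mk, smul_add, smul_sub]
  · simp only [map_smul, Prod.smul_mk, smul_add, smul_sub, smul_inv_smul₀ hγ]
end

section
/- (Non-split lemma of Section 4.2.) Let g be a Lie algebra over ℝ, γ a nonzero real number, and R : g → g a linear map satisfying the non-split mCYBE: ⁅R X, R Y⁆ − R(⁅R X, Y⁆ + ⁅X, R Y⁆) = ⁅X, Y⁆ for all X, Y ∈ g. Let g^ℂ := ℂ ⊗_ℝ g be the complexified Lie algebra, regarded also as a real Lie algebra, let θ : g^ℂ → g^ℂ be the conjugation θ(z ⊗ X) = z̄ ⊗ X, and extend R ℂ-linearly to g^ℂ; set R^± := R ± i·id. Then: (i) g_± := {γ • R^± (1 ⊗ X) : X ∈ g} = {γ • (1 ⊗ R X ± i ⊗ X) : X ∈ g} are real Lie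 subalgebras of g^ℂ; (ii) θ(g_±) = g_∓; and (iii) the maps Δ_± : g_R → g^ℂ, X ↦ γ • (1 ⊗ R X ± i ⊗ X), are injective homomorphisms of real Lie algebras from g_R (the underlying space of g with bracket ⁅X, Y⁆_R = γ(⁅R X, Y⁆ + ⁅X, R Y⁆)) onto g_±, with inverses given on g_± by Z ↦ ±(Z − θ(Z))/(2iγ) (an element of the real form 1 ⊗ g, identified with g). -/
open TensorProduct

/-- Complex conjugation `θ` on `ℂ ⊗_ℝ g` relative to the real form `1 ⊗ g`,
`θ(z ⊗ X) = z̄ ⊗ X`. -/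
noncomputable def conjTheta (g : Type*) [AddCommGroup g] [Module ℝ g] :
    ℂ ⊗[ℝ] g →ₗ[ℝ] ℂ ⊗[ℝ] g :=
  TensorProduct.map Complex.conjAe.toLinearMap LinearMap.id

/-- `Δ₊ : X ↦ γ • (1 ⊗ R X + i ⊗ X)`. -/
noncomputable def DeltaP {g : Type*} [AddCommGroup g] [Module ℝ g]
    (R : g →ₗ[ℝ] g) (γ : ℝ) (X : g) : ℂ ⊗[ℝ] g :=
  γ • ((1 : ℂ) ⊗ₜ[ℝ] R X + Complex.I ⊗ₜ[ℝ] X)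

/-- `Δ₋ : X ↦ γ • (1 ⊗ R X − i ⊗ X)`. -/
noncomputable def DeltaM {g : Type*} [AddCommGroup g] [Module ℝ g]
    (R : g →ₗ[ℝ] g) (γ : ℝ) (X : g) : ℂ ⊗[ℝ] g :=
  γ • ((1 : ℂ) ⊗ₜ[ℝ] R X - Complex.I ⊗ₜ[ℝ] X)

theorem aux_P_eq {g : Type*} [AddCommGroup g] [Module ℝ g] (R : g →ₗ[ℝ] g) (γ : ℝ) (X : g) :
    DeltaP R γ X = (1 : ℂ) ⊗ₜ[ℝ] (γ • R X) + Complex.I ⊗ₜ[ℝ] (γ • X) := by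
  simp only [DeltaP, smul_add, TensorProduct.tmul_smul]

theorem aux_M_eq {g : Type*} [AddCommGroup g] [Module ℝ g] (R : g →ₗ[ℝ] g) (γ : ℝ) (X : g) :
    DeltaM R γ X = (1 : ℂ) ⊗ₜ[ℝ] (γ • R X) - Complex.I ⊗ₜ[ℝ] (γ • X) := by
  simp only [DeltaM, smul_sub, TensorProduct.tmul_smul]

theorem aux_theta_P {g : Type*} [AddCommGroup g] [Module ℝ g] (R : g →ₗ[ℝ] g) (γ : ℝ) (X : g) :
    conjTheta g (DeltaP R γ X) = DeltaM R γ X := by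
  simp [DeltaP, DeltaM, conjTheta, TensorProduct.neg_tmul, sub_eq_add_neg]

theorem aux_theta_M {g : Type*} [AddCommGroup g] [Module ℝ g] (R : g →ₗ[ℝ] g) (γ : ℝ) (X : g) :
    conjTheta g (DeltaM R γ X) = DeltaP R γ X := by
  simp [DeltaP, DeltaM, conjTheta, TensorProduct.neg_tmul]

theorem aux_inj {g : Type*} [AddCommGroup g] [Module ℝ g] :
    Function.Injective (fun X : g => (1 : ℂ) ⊗ₜ[ℝ] X) := by
  intro X Y h
  have := congrArg (fun Z => TensorProduct.lid ℝ g (LinearMap.rTensor g Complex.reLm Z)) h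
  simpa using this

theorem aux_invP {g : Type*} [AddCommGroup g] [Module ℝ g] (R : g →ₗ[ℝ] g) (γ : ℝ)
    (hγ : γ ≠ 0) (X : g) :
    (2 * Complex.I * (γ : ℂ))⁻¹ • (DeltaP R γ X - DeltaM R γ X) = (1 : ℂ) ⊗ₜ[ℝ] X := by
  have hc : (γ : ℂ) ≠ 0 := by exact_mod_cast hγ
  have h : DeltaP R γ X - DeltaM R γ X = (2 * Complex.I * (γ : ℂ)) • ((1 : ℂ) ⊗ₜ[ℝ] X) := by
    have e : (2 * Complex.I * (γ : ℂ)) = γ • Complex.I + γ • Complex.I := by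
      simp only [Complex.real_smul]; ring
    rw [TensorProduct.smul_tmul', smul_eq_mul, mul_one, e, TensorProduct.add_tmul,
      ← TensorProduct.smul_tmul', DeltaP, DeltaM, smul_add, smul_sub]
    abel
  rw [h, inv_smul_smul₀]
  simp [hc]

theorem aux_homP {g : Type*} [LieRing g] [LieAlgebra ℝ g]
    (γ : ℝ) (R : g →ₗ[ℝ] g)
    (hR : ∀ X Y : g, ⁅R X, R Y⁆ - R (⁅R X, Y⁆ + ⁅X, R Y⁆) = ⁅X, Y⁆) (X Y : g) :
    DeltaP R γ (γ • (⁅R X, Y⁆ + ⁅X, R Y⁆)) = ⁅DeltaP R γ X, DeltaP R γ Y⁆ := by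
  have h : R (⁅R X, Y⁆ + ⁅X, R Y⁆) = ⁅R X, R Y⁆ - ⁅X, Y⁆ := by rw [← hR X Y]; abel
  rw [aux_P_eq, map_smul, h]
  simp only [aux_P_eq, lie_add, add_lie, LieAlgebra.ExtendScalars.bracket_tmul,
    smul_lie, lie_smul, one_mul, mul_one, Complex.I_mul_I, TensorProduct.neg_tmul, smul_add,
    smul_sub, TensorProduct.tmul_add, TensorProduct.tmul_sub]
  abel

theorem aux_homM {g : Type*} [LieRing g] [LieAlgebra ℝ g]
    (γ : ℝ) (R : g →ₗ[ℝ] g)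
    (hR : ∀ X Y : g, ⁅R X, R Y⁆ - R (⁅R X, Y⁆ + ⁅X, R Y⁆) = ⁅X, Y⁆) (X Y : g) :
    DeltaM R γ (γ • (⁅R X, Y⁆ + ⁅X, R Y⁆)) = ⁅DeltaM R γ X, DeltaM R γ Y⁆ := by
  have h : R (⁅R X, Y⁆ + ⁅X, R Y⁆) = ⁅R X, R Y⁆ - ⁅X, Y⁆ := by rw [← hR X Y]; abel
  rw [aux_M_eq, map_smul, h]
  simp only [aux_M_eq, lie_sub, sub_lie, LieAlgebra.ExtendScalars.bracket_tmul,
    smul_lie, lie_smul, one_mul, mul_one, Complex.I_mul_I, TensorProduct.neg_tmul, smul_add,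
    smul_sub, TensorProduct.tmul_add, TensorProduct.tmul_sub]
  abel

/-- (Non-split lemma of Section 4.2.) If `R` solves the non-split mCYBE on a real Lie
algebra `g` and `γ ≠ 0`, then `g_± = {γ • R^±(1 ⊗ X)} = {γ • (1 ⊗ R X ± i ⊗ X)}` are real
Lie subalgebras of `g^ℂ = ℂ ⊗_ℝ g`, exchanged by the conjugation `θ`, and the maps `Δ_±`
are injective Lie algebra morphisms from `g_R` onto `g_±` with inverses
`Z ↦ ±(Z − θ(Z))/(2iγ)`, landing in the real form `1 ⊗ g`. -/
theorem nonsplit_gpm_lemma {g : Type*} [LieRing g] [LieAlgebra ℝ g]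
    (γ : ℝ) (hγ : γ ≠ 0) (R : g →ₗ[ℝ] g)
    (hR : ∀ X Y : g, ⁅R X, R Y⁆ - R (⁅R X, Y⁆ + ⁅X, R Y⁆) = ⁅X, Y⁆) :
    -- the two descriptions of `g_±` agree: `γ • R^±(1 ⊗ X) = γ • (1 ⊗ R X ± i ⊗ X)`
    (∀ X : g, γ • (LinearMap.baseChange ℂ R ((1 : ℂ) ⊗ₜ[ℝ] X)
        + Complex.I • ((1 : ℂ) ⊗ₜ[ℝ] X)) = DeltaP R γ X) ∧
    (∀ X : g, γ • (LinearMap.baseChange ℂ R ((1 : ℂ) ⊗ₜ[ℝ] X)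
        - Complex.I • ((1 : ℂ) ⊗ₜ[ℝ] X)) = DeltaM R γ X) ∧
    -- (i) `g_±` are closed under the bracket of `g^ℂ`
    (∀ X Y : g, ∃ Z : g, ⁅DeltaP R γ X, DeltaP R γ Y⁆ = DeltaP R γ Z) ∧
    (∀ X Y : g, ∃ Z : g, ⁅DeltaM R γ X, DeltaM R γ Y⁆ = DeltaM R γ Z) ∧
    -- (ii) `θ(g_±) = g_∓`
    conjTheta g '' Set.range (DeltaP R γ) = Set.range (DeltaM R γ) ∧
    conjTheta g '' Set.range (DeltaM R γ) = Set.range (DeltaP R γ) ∧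
    -- (iii) `Δ_±` intertwine the `R`-bracket with the bracket of `g^ℂ` ...
    (∀ X Y : g, DeltaP R γ (γ • (⁅R X, Y⁆ + ⁅X, R Y⁆)) = ⁅DeltaP R γ X, DeltaP R γ Y⁆) ∧
    (∀ X Y : g, DeltaM R γ (γ • (⁅R X, Y⁆ + ⁅X, R Y⁆)) = ⁅DeltaM R γ X, DeltaM R γ Y⁆) ∧
    -- ... are injective ...
    Function.Injective (DeltaP R γ) ∧
    Function.Injective (DeltaM R γ) ∧
    -- ... with inverses `Z ↦ ±(Z − θ(Z))/(2iγ)` valued in the real form `1 ⊗ g`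
    (∀ X : g, (2 * Complex.I * (γ : ℂ))⁻¹ • (DeltaP R γ X - conjTheta g (DeltaP R γ X))
        = (1 : ℂ) ⊗ₜ[ℝ] X) ∧
    (∀ X : g, (-(2 * Complex.I * (γ : ℂ))⁻¹) • (DeltaM R γ X - conjTheta g (DeltaM R γ X))
        = (1 : ℂ) ⊗ₜ[ℝ] X) := by
  have tP := aux_theta_P R γ
  have tM := aux_theta_M R γ
  have iP : ∀ X : g, (2 * Complex.I * (γ : ℂ))⁻¹ •
      (DeltaP R γ X - conjTheta g (DeltaP R γ X)) = (1 : ℂ) ⊗ₜ[ℝ] X := by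
    intro X
    rw [tP]; exact aux_invP R γ hγ X
  have iM : ∀ X : g, (-(2 * Complex.I * (γ : ℂ))⁻¹) •
      (DeltaM R γ X - conjTheta g (DeltaM R γ X)) = (1 : ℂ) ⊗ₜ[ℝ] X := by
    intro X
    rw [tM, neg_smul, ← smul_neg, neg_sub]; exact aux_invP R γ hγ X
  refine ⟨?_, ?_, fun X Y => ⟨_, (aux_homP γ R hR X Y).symm⟩,
    fun X Y => ⟨_, (aux_homM γ R hR X Y).symm⟩, ?_, ?_, aux_homP γ R hR, aux_homM γ R hR,
    ?_, ?_, iP, iM⟩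
  · intro X
    simp [DeltaP, TensorProduct.smul_tmul']
  · intro X
    simp [DeltaM, TensorProduct.smul_tmul']
  · rw [← Set.range_comp]
    exact congrArg Set.range (funext tP)
  · rw [← Set.range_comp]
    exact congrArg Set.range (funext tM)
  · intro X Y h
    apply aux_inj
    show (1 : ℂ) ⊗ₜ[ℝ] X = (1 : ℂ) ⊗ₜ[ℝ] Y
    rw [← iP X, ← iP Y, h]
  · intro X Y h
    apply aux_inj
    show (1 : ℂ) ⊗ₜ[ℝ] X = (1 : ℂ) ⊗ₜ[ℝ] Y
    rw [← iM X, ← iM Y, h]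
end

section
/- (Content of Lemma 4.4.) Let g be a Lie algebra over ℝ with a symmetric invariant bilinear form κ (κ(⁅X, Y⁆, Z) = κ(X, ⁅Y, Z⁆)), and let γ be a nonzero real number. Let κ^ℂ denote the ℂ-bilinear extension of κ to the complexification g^ℂ = ℂ ⊗_ℝ g, i.e. κ^ℂ(z ⊗ X, w ⊗ Y) = z w κ(X, Y). Define the real-valued symmetric bilinear form ⟨X|Y⟩ := (1/γ) · Im(κ^ℂ(X, Y)) on g^ℂ regarded as a real Lie algebra. Then: (i) ⟨·|·⟩ is invariant; (ii) if κ is nondegenerate then ⟨·|·⟩ is nondegenerate; (iii) the real form 1 ⊗ g is isotropic for ⟨·|·⟩; and (iv) if moreover R : g → g is skew-symmetric with respect to κ (κ(R X, Y) = −κ(X, R Y)), then the subspaces g_± = {γ • (1 ⊗ R X ± i ⊗ X) : X ∈ g} are isotropic for ⟨·|·⟩. -/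
open TensorProduct

theorem aux_decomp {g : Type*} [LieRing g] [LieAlgebra ℝ g] (p : ℂ ⊗[ℝ] g) :
    ∃ X Y : g, p = (1 : ℂ) ⊗ₜ[ℝ] X + Complex.I ⊗ₜ[ℝ] Y := by
  induction p using TensorProduct.induction_on with
  | zero => exact ⟨0, 0, by simp⟩
  | tmul z X =>
    refine ⟨z.re • X, z.im • X, ?_⟩
    rw [← TensorProduct.smul_tmul, ← TensorProduct.smul_tmul, ← TensorProduct.add_tmul]
    congr 1
    apply Complex.ext <;> simp
  | add a b ha hb =>
    obtain ⟨X, Y, rfl⟩ := ha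
    obtain ⟨X', Y', rfl⟩ := hb
    refine ⟨X + X', Y + Y', ?_⟩
    rw [TensorProduct.tmul_add, TensorProduct.tmul_add]
    abel

theorem aux_inv {g : Type*} [LieRing g] [LieAlgebra ℝ g]
    (κ : g →ₗ[ℝ] g →ₗ[ℝ] ℝ)
    (hinvar : ∀ X Y Z : g, κ ⁅X, Y⁆ Z = κ X ⁅Y, Z⁆) (p q r : ℂ ⊗[ℝ] g) :
    LinearMap.BilinForm.baseChange ℂ κ ⁅p, q⁆ r = LinearMap.BilinForm.baseChange ℂ κ p ⁅q, r⁆ := by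
  have hadd : ∀ a b c : ℂ ⊗[ℝ] g, ⁅a, b + c⁆ = ⁅a, b⁆ + ⁅a, c⁆ := fun a b c => lie_add a b c
  have hzero : ∀ a : ℂ ⊗[ℝ] g, ⁅a, (0 : ℂ ⊗[ℝ] g)⁆ = 0 := fun a => lie_zero a
  induction p using TensorProduct.induction_on with
  | zero => simp
  | add a b ha hb => simp only [add_lie, map_add, LinearMap.add_apply, ha, hb]
  | tmul x X =>
  induction q using TensorProduct.induction_on with
  | zero => simp [hzero]
  | add a b ha hb => simp only [add_lie, hadd, map_add, LinearMap.add_apply, ha, hb]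
  | tmul y Y =>
  induction r using TensorProduct.induction_on with
  | zero => simp [hzero]
  | add a b ha hb => simp only [hadd, map_add, ha, hb]
  | tmul z Z =>
    simp only [LieAlgebra.ExtendScalars.bracket_tmul, LinearMap.BilinForm.baseChange_tmul, hinvar]
    congr 1
    ring

/-- (Content of Lemma 4.4.) Let `κ` be a symmetric invariant bilinear form on a real Lie
algebra `g`, `γ ≠ 0`, and `κ^ℂ` its `ℂ`-bilinear extension to `g^ℂ = ℂ ⊗_ℝ g`; consider
the real-valued form `⟨X|Y⟩ = Im(κ^ℂ(X,Y))/γ` on `g^ℂ`. Then `⟨·|·⟩` is invariant, it is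
nondegenerate whenever `κ` is, the real form `1 ⊗ g` is isotropic for it, and if `R` is
`κ`-skew-symmetric then `g_± = {γ • (1 ⊗ R X ± i ⊗ X)}` are isotropic for it. -/
theorem nonsplit_form_properties {g : Type*} [LieRing g] [LieAlgebra ℝ g]
    (κ : g →ₗ[ℝ] g →ₗ[ℝ] ℝ)
    (hsymm : ∀ X Y : g, κ X Y = κ Y X)
    (hinvar : ∀ X Y Z : g, κ ⁅X, Y⁆ Z = κ X ⁅Y, Z⁆)
    (γ : ℝ) (hγ : γ ≠ 0) :
    ∀ ip : (ℂ ⊗[ℝ] g) → (ℂ ⊗[ℝ] g) → ℝ,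
      (∀ X Y : ℂ ⊗[ℝ] g, ip X Y = (LinearMap.BilinForm.baseChange ℂ κ X Y).im / γ) →
      -- (i) invariance
      ((∀ p q r : ℂ ⊗[ℝ] g, ip ⁅p, q⁆ r = ip p ⁅q, r⁆) ∧
      -- (ii) nondegeneracy
      ((∀ X : g, (∀ Y : g, κ X Y = 0) → X = 0) →
        ∀ p : ℂ ⊗[ℝ] g, (∀ q : ℂ ⊗[ℝ] g, ip p q = 0) → p = 0) ∧
      -- (iii) the real form `1 ⊗ g` is isotropic
      (∀ X Y : g, ip ((1 : ℂ) ⊗ₜ[ℝ] X) ((1 : ℂ) ⊗ₜ[ℝ] Y) = 0) ∧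
      -- (iv) `g_±` are isotropic when `R` is `κ`-skew-symmetric
      (∀ R : g →ₗ[ℝ] g, (∀ X Y : g, κ (R X) Y = - κ X (R Y)) →
        (∀ X Y : g,
          ip (γ • ((1 : ℂ) ⊗ₜ[ℝ] R X + Complex.I ⊗ₜ[ℝ] X))
             (γ • ((1 : ℂ) ⊗ₜ[ℝ] R Y + Complex.I ⊗ₜ[ℝ] Y)) = 0) ∧
        (∀ X Y : g,
          ip (γ • ((1 : ℂ) ⊗ₜ[ℝ] R X - Complex.I ⊗ₜ[ℝ] X))
             (γ • ((1 : ℂ) ⊗ₜ[ℝ] R Y - Complex.I ⊗ₜ[ℝ] Y)) = 0))) := by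
  intro ip hip
  refine ⟨fun p q r => by rw [hip, hip, aux_inv κ hinvar], ?_, ?_, ?_⟩
  · intro hnd p hp
    obtain ⟨X, Y, rfl⟩ := aux_decomp p
    have hY : Y = 0 := by
      apply hnd
      intro Z
      have h := hp ((1 : ℂ) ⊗ₜ[ℝ] Z)
      rw [hip] at h
      simpa [LinearMap.BilinForm.baseChange_tmul, hγ] using h
    have hX : X = 0 := by
      apply hnd
      intro Z
      have h := hp (Complex.I ⊗ₜ[ℝ] Z)
      rw [hip] at h
      simpa [LinearMap.BilinForm.baseChange_tmul, hγ] using h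
    simp [hX, hY]
  · intro X Y
    rw [hip]
    simp [LinearMap.BilinForm.baseChange_tmul]
  · intro R hR
    constructor <;> intro X Y <;> rw [hip] <;>
      simp only [smul_add, smul_sub, map_add, map_sub,
        LinearMap.add_apply, LinearMap.sub_apply, TensorProduct.smul_tmul',
        LinearMap.BilinForm.baseChange_tmul] <;>
      simp [hR]
end

section
/- (Standard R-matrix solves the mCYBE.) Let l be a Lie algebra over a field k equipped with a decomposition l = n₋ ⊕ h ⊕ n₊ as a direct sum of submodules, where n₊ and n₋ are Lie subalgebras of l, h is an abelian Lie subalgebra of l (⁅h, h⁆ = 0), and ⁅h, n₊⁆ ⊆ n₊ and ⁅h, n₋⁆ ⊆ n₋. Let π₊ and π₋ be the projections onto n₊ and n₋ along this decomposition. Then for any scalar c ∈ k, the linear map R := c • (π₊ − π₋) satisfies the mCYBE with constant c: ⁅R X, R Y⁆ − R(⁅R X, Y⁆ + ⁅X, R Y⁆) = −c² • ⁅X, Y⁆ for all X, Y ∈ l. -/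
/-- (Standard R-matrix solves the mCYBE.) Let `l = n₋ ⊕ h ⊕ n₊` be a direct sum
decomposition of a Lie algebra into Lie subalgebras where `h` is abelian, `⁅h, n₊⁆ ⊆ n₊`
and `⁅h, n₋⁆ ⊆ n₋`, with projections `π₊`, `π₀`, `π₋` along the decomposition. Then for
any scalar `c`, the map `R = c • (π₊ − π₋)` satisfies the mCYBE with constant `c`. -/
theorem standard_R_matrix_mCYBE {k l : Type*} [Field k] [LieRing l] [LieAlgebra k l]
    (np nm hh : LieSubalgebra k l)
    (habelian : ∀ x ∈ hh, ∀ y ∈ hh, ⁅x, y⁆ = (0 : l))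
    (hbp : ∀ x ∈ hh, ∀ y ∈ np, ⁅x, y⁆ ∈ np)
    (hbm : ∀ x ∈ hh, ∀ y ∈ nm, ⁅x, y⁆ ∈ nm)
    (πp π0 πm : l →ₗ[k] l)
    (hmem : ∀ x : l, πp x ∈ np ∧ π0 x ∈ hh ∧ πm x ∈ nm)
    (hsum : ∀ x : l, πm x + π0 x + πp x = x)
    (hindep : ∀ a ∈ nm, ∀ b ∈ hh, ∀ c ∈ np, a + b + c = 0 → a = 0 ∧ b = 0 ∧ c = 0)
    (c : k) :
    ∀ X Y : l,
      ⁅c • (πp X - πm X), c • (πp Y - πm Y)⁆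
          - c • (πp (⁅c • (πp X - πm X), Y⁆ + ⁅X, c • (πp Y - πm Y)⁆)
                 - πm (⁅c • (πp X - πm X), Y⁆ + ⁅X, c • (πp Y - πm Y)⁆))
        = (-(c ^ 2)) • ⁅X, Y⁆ := by
  intro X Y
  have key : ∀ a ∈ np, ∀ b ∈ nm, πp (a - b) = a ∧ πm (a - b) = -b := by
    intro a ha b hb
    obtain ⟨h1, h2, h3⟩ := hmem (a - b)
    have h4 := hsum (a - b)
    have := hindep (πm (a - b) + b) (nm.add_mem h3 hb) _ h2 (πp (a - b) - a)
      (np.sub_mem h1 ha) (by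
        generalize πm (a - b) = u at *
        generalize πp (a - b) = v at *
        generalize π0 (a - b) = w at *
        have : u + b + w + (v - a) = (u + w + v) - (a - b) := by abel
        rw [this, h4, sub_self])
    exact ⟨sub_eq_zero.mp this.2.2, eq_neg_of_add_eq_zero_left this.1⟩
  obtain ⟨hp, h0, hm⟩ := hmem X
  obtain ⟨hp', h0', hm'⟩ := hmem Y
  have hX := hsum X
  have hY := hsum Y
  generalize πp X = p at *
  generalize πm X = m at *
  generalize π0 X = h at *
  generalize πp Y = p' at *
  generalize πm Y = m' at *
  generalize π0 Y = h' at *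
  subst hX hY
  have hA : ⁅p, p'⁆ + ⁅p, p'⁆ + ⁅h, p'⁆ - ⁅h', p⁆ ∈ np :=
    np.sub_mem (np.add_mem (np.add_mem (np.lie_mem hp hp') (np.lie_mem hp hp'))
      (hbp _ h0 _ hp')) (hbp _ h0' _ hp)
  have hB : ⁅m, m'⁆ + ⁅m, m'⁆ + ⁅h, m'⁆ - ⁅h', m⁆ ∈ nm :=
    nm.sub_mem (nm.add_mem (nm.add_mem (nm.lie_mem hm hm') (nm.lie_mem hm hm'))
      (hbm _ h0 _ hm')) (hbm _ h0' _ hm)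
  obtain ⟨k1, k2⟩ := key _ hA _ hB
  have hS : ⁅c • (p - m), m' + h' + p'⁆ + ⁅m + h + p, c • (p' - m')⁆
      = c • ((⁅p, p'⁆ + ⁅p, p'⁆ + ⁅h, p'⁆ - ⁅h', p⁆)
        - (⁅m, m'⁆ + ⁅m, m'⁆ + ⁅h, m'⁆ - ⁅h', m⁆)) := by
    rw [smul_lie, lie_smul, ← smul_add]
    congr 1
    simp only [lie_add, add_lie, lie_sub, sub_lie]
    rw [← lie_skew p h', ← lie_skew m h']
    abel
  rw [hS, map_smul, map_smul, k1, k2, smul_lie, lie_smul, ← smul_sub, ← smul_sub, ← smul_sub,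
    smul_smul, neg_smul, ← smul_neg, pow_two]
  congr 1
  simp only [lie_add, add_lie, lie_sub, sub_lie]
  rw [habelian _ h0 _ h0', ← lie_skew p h', ← lie_skew m h']
  abel
end

section
/- (Theorem D.1, Poisson bracket extraction from a two-factor decomposition.) Let k be a field, S a commutative k-algebra, and {·,·} : S × S → S a k-bilinear map that is a derivation in each argument. Extend {·,·} entrywise to matrices: for A ∈ Mat_n(S) and B ∈ Mat_m(S), let {A₁, B₂} ∈ Mat_{n·m}(S) be the matrix with entries {A₁, B₂}_{(i,k'),(j,l)} = {A_{ij}, B_{k'l}}, and identify A₁ = A ⊗ₖ 1_m, B₂ = 1_n ⊗ₖ B via the Kronecker product. Let f₁ = g₁ ⊕ h₁ be a direct sum of k-subspaces of Mat_n(k) and f₂ = g₂ ⊕ h₂ a direct sum of k-subspaces of Mat_m(k), with projections π_{g₁}, π_{h₁}, π_{g₂}, π_{h₂}, which extend S-linearly to the S-span of f₁ ⊗ₖ f₂ inside Mat_{n·m}(S). Let u, v ∈ GL_n(S), x, y ∈ GL_m(S), and set A = u·v, B = x·y. Assume the 'log-derivative' conditions: (u⁻¹ ⊗ₖ x⁻¹)·{u₁,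 x₂} lies in the S-span of g₁ ⊗ₖ g₂; (u⁻¹ ⊗ₖ 1)·{u₁, y₂}·(1 ⊗ₖ y⁻¹) lies in the S-span of g₁ ⊗ₖ h₂; (1 ⊗ₖ x⁻¹)·{v₁, x₂}·(v⁻¹ ⊗ₖ 1) lies in the S-span of h₁ ⊗ₖ g₂; and {v₁, y₂}·(v⁻¹ ⊗ₖ y⁻¹) lies in the S-span of h₁ ⊗ₖ h₂. Define P := (u⁻¹ ⊗ₖ x⁻¹)·{A₁, B₂}·(v⁻¹ ⊗ₖ y⁻¹). Then {u₁, x₂} = (u ⊗ₖ x)·(π_{g₁} ⊗ π_{g₂})(P), {u₁, y₂} = (u ⊗ₖ 1)·(π_{g₁} ⊗ π_{h₂})(P)·(1 ⊗ₖ y), {v₁, x₂} = (1 ⊗ₖ x)·(π_{h₁} ⊗ π_{g₂})(P)·(v ⊗ₖ 1), and {v₁, y₂} = (π_{h₁} ⊗ π_{h₂})(P)·(v ⊗ₖ y). -/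
open Matrix
open scoped Kronecker

/-- The `S`-span, inside matrices over `S`, of the Kronecker products of elements of two
`k`-subspaces of matrices over `k`. -/
def kronSpan {k S : Type*} [CommRing k] [CommRing S] [Algebra k S]
    {ι₁ ι₂ : Type*}
    (W₁ : Submodule k (Matrix ι₁ ι₁ k)) (W₂ : Submodule k (Matrix ι₂ ι₂ k)) :
    Submodule S (Matrix (ι₁ × ι₂) (ι₁ × ι₂) S) :=
  Submodule.span S
    {M | ∃ P ∈ W₁, ∃ Q ∈ W₂,
      M = (P.map (algebraMap k S)) ⊗ₖ (Q.map (algebraMap k S))}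

theorem km_left {S : Type*} [CommRing S] {ι₁ ι₂ : Type*} [Fintype ι₁] [DecidableEq ι₁]
    [Fintype ι₂] [DecidableEq ι₂] (br : S → S → S)
    (h0 : ∀ r, br 0 r = 0) (hadd : ∀ s t r, br (s + t) r = br s r + br t r)
    (hder : ∀ s t r : S, br (s * t) r = s * br t r + t * br s r)
    (u v : Matrix ι₁ ι₁ S) (B : Matrix ι₂ ι₂ S) :
    kroneckerMap br (u * v) B = (u ⊗ₖ (1 : Matrix ι₂ ι₂ S)) * kroneckerMap br v B
      + kroneckerMap br u B * (v ⊗ₖ (1 : Matrix ι₂ ι₂ S)) := by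
  ext ⟨i, p⟩ ⟨j, q⟩
  have hs : ∀ (r : S) (f : ι₁ → S), br (∑ a, f a) r = ∑ a, br (f a) r := fun r f =>
    map_sum (⟨⟨fun s => br s r, h0 r⟩, fun s t => hadd s t r⟩ : S →+ S) f Finset.univ
  simp [Matrix.mul_apply, kroneckerMap_apply, Fintype.sum_prod_type, Matrix.one_apply, hs, hder,
    Finset.sum_add_distrib, mul_comm]

theorem km_right {S : Type*} [CommRing S] {ι₁ ι₂ : Type*} [Fintype ι₁] [DecidableEq ι₁]
    [Fintype ι₂] [DecidableEq ι₂] (br : S → S → S)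
    (h0 : ∀ r, br r 0 = 0) (hadd : ∀ s t r, br r (s + t) = br r s + br r t)
    (hder : ∀ r s t : S, br r (s * t) = s * br r t + t * br r s)
    (A : Matrix ι₁ ι₁ S) (x y : Matrix ι₂ ι₂ S) :
    kroneckerMap br A (x * y) = ((1 : Matrix ι₁ ι₁ S) ⊗ₖ x) * kroneckerMap br A y
      + kroneckerMap br A x * ((1 : Matrix ι₁ ι₁ S) ⊗ₖ y) := by
  ext ⟨i, p⟩ ⟨j, q⟩
  have hs : ∀ (r : S) (f : ι₂ → S), br r (∑ a, f a) = ∑ a, br r (f a) := fun r f =>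
    map_sum (⟨⟨fun s => br r s, h0 r⟩, fun s t => hadd s t r⟩ : S →+ S) f Finset.univ
  simp [Matrix.mul_apply, kroneckerMap_apply, Fintype.sum_prod_type_right, Matrix.one_apply, hs,
    hder, Finset.sum_add_distrib, mul_comm]

/-- (Theorem D.1, Poisson bracket extraction from a two-factor decomposition, in matrix
form.) Given a `k`-bilinear bracket on `S` which is a derivation in each argument, direct
sum decompositions `f₁ = g₁ ⊕ h₁`, `f₂ = g₂ ⊕ h₂` of subspaces of matrices over `k` with
projections extended `S`-linearly, invertible matrices `u, v, x, y` over `S`, and the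
assumption that the logarithmic-derivative combinations of `{u₁,x₂}`, `{u₁,y₂}`,
`{v₁,x₂}`, `{v₁,y₂}` lie in the corresponding blocks, the brackets of the factors are
recovered from `P = (u⁻¹ ⊗ x⁻¹)·{A₁,B₂}·(v⁻¹ ⊗ y⁻¹)` (with `A = u·v`, `B = x·y`) by
applying the block projections. -/
theorem poisson_extraction_two_factor {k S : Type*} [Field k] [CommRing S] [Algebra k S]
    {ι₁ ι₂ : Type*} [Fintype ι₁] [DecidableEq ι₁] [Fintype ι₂] [DecidableEq ι₂]
    (br : S → S → S)
    (hbil_l : ∀ (a : k) (s t r : S), br (a • s + t) r = a • br s r + br t r)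
    (hbil_r : ∀ (a : k) (s t r : S), br r (a • s + t) = a • br r s + br r t)
    (hder_l : ∀ s t r : S, br (s * t) r = s * br t r + t * br s r)
    (hder_r : ∀ r s t : S, br r (s * t) = s * br r t + t * br r s)
    (g₁ h₁ : Submodule k (Matrix ι₁ ι₁ k)) (g₂ h₂ : Submodule k (Matrix ι₂ ι₂ k))
    (hdisj₁ : g₁ ⊓ h₁ = ⊥) (hdisj₂ : g₂ ⊓ h₂ = ⊥)
    (prGG prGH prHG prHH :
      Matrix (ι₁ × ι₂) (ι₁ × ι₂) S →ₗ[S] Matrix (ι₁ × ι₂) (ι₁ × ι₂) S)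
    (hprGG : (∀ M ∈ kronSpan g₁ g₂, prGG M = M) ∧ (∀ M ∈ kronSpan g₁ h₂, prGG M = 0) ∧
            (∀ M ∈ kronSpan h₁ g₂, prGG M = 0) ∧ (∀ M ∈ kronSpan h₁ h₂, prGG M = 0))
    (hprGH : (∀ M ∈ kronSpan g₁ h₂, prGH M = M) ∧ (∀ M ∈ kronSpan g₁ g₂, prGH M = 0) ∧
            (∀ M ∈ kronSpan h₁ g₂, prGH M = 0) ∧ (∀ M ∈ kronSpan h₁ h₂, prGH M = 0))
    (hprHG : (∀ M ∈ kronSpan h₁ g₂, prHG M = M) ∧ (∀ M ∈ kronSpan g₁ g₂, prHG M = 0) ∧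
            (∀ M ∈ kronSpan g₁ h₂, prHG M = 0) ∧ (∀ M ∈ kronSpan h₁ h₂, prHG M = 0))
    (hprHH : (∀ M ∈ kronSpan h₁ h₂, prHH M = M) ∧ (∀ M ∈ kronSpan g₁ g₂, prHH M = 0) ∧
            (∀ M ∈ kronSpan g₁ h₂, prHH M = 0) ∧ (∀ M ∈ kronSpan h₁ g₂, prHH M = 0))
    (u v ui vi : Matrix ι₁ ι₁ S) (x y xi yi : Matrix ι₂ ι₂ S)
    (hu : u * ui = 1 ∧ ui * u = 1) (hv : v * vi = 1 ∧ vi * v = 1)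
    (hx : x * xi = 1 ∧ xi * x = 1) (hy : y * yi = 1 ∧ yi * y = 1)
    (h1 : (ui ⊗ₖ xi) * kroneckerMap br u x ∈ kronSpan g₁ g₂)
    (h2 : (ui ⊗ₖ (1 : Matrix ι₂ ι₂ S)) * kroneckerMap br u y * ((1 : Matrix ι₁ ι₁ S) ⊗ₖ yi)
        ∈ kronSpan g₁ h₂)
    (h3 : ((1 : Matrix ι₁ ι₁ S) ⊗ₖ xi) * kroneckerMap br v x * (vi ⊗ₖ (1 : Matrix ι₂ ι₂ S))
        ∈ kronSpan h₁ g₂)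
    (h4 : kroneckerMap br v y * (vi ⊗ₖ yi) ∈ kronSpan h₁ h₂) :
    ∀ P : Matrix (ι₁ × ι₂) (ι₁ × ι₂) S,
      P = (ui ⊗ₖ xi) * kroneckerMap br (u * v) (x * y) * (vi ⊗ₖ yi) →
      kroneckerMap br u x = (u ⊗ₖ x) * prGG P ∧
      kroneckerMap br u y
        = (u ⊗ₖ (1 : Matrix ι₂ ι₂ S)) * prGH P * ((1 : Matrix ι₁ ι₁ S) ⊗ₖ y) ∧
      kroneckerMap br v x
        = ((1 : Matrix ι₁ ι₁ S) ⊗ₖ x) * prHG P * (v ⊗ₖ (1 : Matrix ι₂ ι₂ S)) ∧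
      kroneckerMap br v y = prHH P * (v ⊗ₖ y) := by
  intro P hP
  have al : ∀ s t r, br (s + t) r = br s r + br t r := fun s t r => by
    simpa using hbil_l 1 s t r
  have ar : ∀ s t r, br r (s + t) = br r s + br r t := fun s t r => by
    simpa using hbil_r 1 s t r
  have zl : ∀ r, br 0 r = 0 := fun r => by simpa using al 0 0 r
  have zr : ∀ r, br r 0 = 0 := fun r => by simpa using ar 0 0 r
  obtain ⟨hu, hu'⟩ := hu
  obtain ⟨hv, hv'⟩ := hv
  obtain ⟨hx, hx'⟩ := hx
  obtain ⟨hy, hy'⟩ := hy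
  have key : P = (ui ⊗ₖ xi) * kroneckerMap br u x
      + (ui ⊗ₖ (1 : Matrix ι₂ ι₂ S)) * kroneckerMap br u y * ((1 : Matrix ι₁ ι₁ S) ⊗ₖ yi)
      + ((1 : Matrix ι₁ ι₁ S) ⊗ₖ xi) * kroneckerMap br v x * (vi ⊗ₖ (1 : Matrix ι₂ ι₂ S))
      + kroneckerMap br v y * (vi ⊗ₖ yi) := by
    rw [hP, km_left br zl al hder_l, km_right br zr ar hder_r, km_right br zr ar hder_r]
    generalize kroneckerMap br u x = X1
    generalize kroneckerMap br u y = X2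
    generalize kroneckerMap br v x = X3
    generalize kroneckerMap br v y = X4
    have e1 : (ui ⊗ₖ xi) * (u ⊗ₖ (1 : Matrix ι₂ ι₂ S)) = (1 : Matrix ι₁ ι₁ S) ⊗ₖ xi := by
      rw [← mul_kronecker_mul, hu', mul_one]
    have e2 : ((1 : Matrix ι₁ ι₁ S) ⊗ₖ xi) * ((1 : Matrix ι₁ ι₁ S) ⊗ₖ x) = 1 := by
      rw [← mul_kronecker_mul, hx', mul_one, one_kronecker_one]
    have e3 : (ui ⊗ₖ xi) * ((1 : Matrix ι₁ ι₁ S) ⊗ₖ x) = ui ⊗ₖ (1 : Matrix ι₂ ι₂ S) := by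
      rw [← mul_kronecker_mul, hx', mul_one]
    have e4 : (v ⊗ₖ (1 : Matrix ι₂ ι₂ S)) * (vi ⊗ₖ yi) = (1 : Matrix ι₁ ι₁ S) ⊗ₖ yi := by
      rw [← mul_kronecker_mul, hv, one_mul]
    have e5 : ((1 : Matrix ι₁ ι₁ S) ⊗ₖ y) * (vi ⊗ₖ yi) = vi ⊗ₖ (1 : Matrix ι₂ ι₂ S) := by
      rw [← mul_kronecker_mul, hy, one_mul]
    have e6 : ((1 : Matrix ι₁ ι₁ S) ⊗ₖ y) * ((1 : Matrix ι₁ ι₁ S) ⊗ₖ yi) = 1 := by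
      rw [← mul_kronecker_mul, hy, mul_one, one_kronecker_one]
    simp only [mul_add, add_mul, Matrix.mul_assoc, e4, e5, e6]
    simp only [← Matrix.mul_assoc, e1, e2, e3, Matrix.one_mul]
    simp only [Matrix.mul_assoc, e6, Matrix.mul_one]
    abel
  have c1 : (u ⊗ₖ x) * (ui ⊗ₖ xi) = 1 := by
    rw [← mul_kronecker_mul, hu, hx, one_kronecker_one]
  have c2 : (u ⊗ₖ (1 : Matrix ι₂ ι₂ S)) * (ui ⊗ₖ (1 : Matrix ι₂ ι₂ S)) = 1 := by
    rw [← mul_kronecker_mul, hu, mul_one, one_kronecker_one]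
  have c3 : ((1 : Matrix ι₁ ι₁ S) ⊗ₖ yi) * ((1 : Matrix ι₁ ι₁ S) ⊗ₖ y) = 1 := by
    rw [← mul_kronecker_mul, hy', mul_one, one_kronecker_one]
  have c4 : ((1 : Matrix ι₁ ι₁ S) ⊗ₖ x) * ((1 : Matrix ι₁ ι₁ S) ⊗ₖ xi) = 1 := by
    rw [← mul_kronecker_mul, hx, mul_one, one_kronecker_one]
  have c5 : (vi ⊗ₖ (1 : Matrix ι₂ ι₂ S)) * (v ⊗ₖ (1 : Matrix ι₂ ι₂ S)) = 1 := by
    rw [← mul_kronecker_mul, hv', mul_one, one_kronecker_one]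
  have c6 : (vi ⊗ₖ yi) * (v ⊗ₖ y) = 1 := by
    rw [← mul_kronecker_mul, hv', hy', one_kronecker_one]
  refine ⟨?_, ?_, ?_, ?_⟩
  · rw [key, map_add, map_add, map_add, hprGG.1 _ h1, hprGG.2.1 _ h2, hprGG.2.2.1 _ h3,
      hprGG.2.2.2 _ h4, add_zero, add_zero, add_zero, ← Matrix.mul_assoc, c1, Matrix.one_mul]
  · rw [key, map_add, map_add, map_add, hprGH.1 _ h2, hprGH.2.1 _ h1, hprGH.2.2.1 _ h3,
      hprGH.2.2.2 _ h4, add_zero, add_zero, zero_add, Matrix.mul_assoc, Matrix.mul_assoc, c3,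
      Matrix.mul_one, ← Matrix.mul_assoc, c2, Matrix.one_mul]
  · rw [key, map_add, map_add, map_add, hprHG.1 _ h3, hprHG.2.1 _ h1, hprHG.2.2.1 _ h2,
      hprHG.2.2.2 _ h4, add_zero, add_zero, zero_add, Matrix.mul_assoc, Matrix.mul_assoc, c5,
      Matrix.mul_one, ← Matrix.mul_assoc, c4, Matrix.one_mul]
  · rw [key, map_add, map_add, map_add, hprHH.1 _ h4, hprHH.2.1 _ h1, hprHH.2.2.1 _ h2,
      hprHH.2.2.2 _ h3, add_zero, add_zero, zero_add, Matrix.mul_assoc, c6, Matrix.mul_one]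
end

section
/- (Theorem D.2, Poisson bracket extraction from a multi-factor decomposition.) Let k be a field, S a commutative k-algebra, and {·,·} : S × S → S a k-bilinear map that is a derivation in each argument; for a matrix A over S and f ∈ S let {A, f} denote the entrywise bracket. Let g₁, …, g_p be k-subspaces of Mat_n(k) whose (internal) direct sum is a subspace g = g₁ ⊕ ⋯ ⊕ g_p, with projections π_i : g → g_i extended S-linearly to the S-span of g in Mat_n(S). Fix i ∈ {1, …, p}, write g_{<i} := g₁ ⊕ ⋯ ⊕ g_{i−1} and g_{>i} := g_{i+1} ⊕ ⋯ ⊕ g_p, and let A = A⁽¹⁾·A⁽²⁾·⋯·A⁽ᵖ⁾ with each A⁽ᵏ⁾ ∈ GL_n(S). Let B := A⁽¹⁾⋯A⁽ⁱ⁻¹⁾ and C := A⁽ⁱ⁺¹⁾⋯A⁽ᵖ⁾, and f ∈ S. Assume: (a) (A⁽ⁱ⁾)⁻¹·{A⁽ⁱ⁾, f} lies in the S-span of g_i; (b) B⁻¹·{B, f} lies in the S-span of g_{<i}; (c) {C, f}·C⁻¹ lies in the S-span of g_{>i}; and (d) conjugation by A⁽ⁱ⁾ preserves the S-span of g_{<i},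 i.e. (A⁽ⁱ⁾)⁻¹·W·A⁽ⁱ⁾ lies in the S-span of g_{<i} for every W in the S-span of g_{<i}. Define P := (A⁽¹⁾⋯A⁽ⁱ⁾)⁻¹·{A, f}·(A⁽ⁱ⁺¹⁾⋯A⁽ᵖ⁾)⁻¹. Then (A⁽ⁱ⁾)⁻¹·{A⁽ⁱ⁾, f} = π_i(P). -/
open Matrix

/-- The `S`-span, inside matrices over `S`, of a `k`-subspace of matrices over `k`. -/
def matSpan {k S : Type*} [CommRing k] [CommRing S] [Algebra k S]
    {ι : Type*} (W : Submodule k (Matrix ι ι k)) :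
    Submodule S (Matrix ι ι S) :=
  Submodule.span S ((fun P : Matrix ι ι k => P.map (algebraMap k S)) '' (W : Set (Matrix ι ι k)))

theorem aux_prod_inv {M α : Type*} [Monoid M] (A Ai : α → M)
    (h : ∀ j, A j * Ai j = 1) (L : List α) :
    (L.map A).prod * (L.map Ai).reverse.prod = 1 := by
  induction L with
  | nil => simp
  | cons a L ih =>
    simp only [List.map_cons, List.prod_cons, List.reverse_cons, List.prod_append,
      List.prod_nil, mul_one]
    calc A a * (L.map A).prod * ((L.map Ai).reverse.prod * Ai a)
        = A a * ((L.map A).prod * (L.map Ai).reverse.prod) * Ai a := by simp only [mul_assoc]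
      _ = 1 := by rw [ih, mul_one, h]

theorem aux_inv_prod {M α : Type*} [Monoid M] (A Ai : α → M)
    (h : ∀ j, Ai j * A j = 1) (L : List α) :
    (L.map Ai).reverse.prod * (L.map A).prod = 1 := by
  induction L with
  | nil => simp
  | cons a L ih =>
    simp only [List.map_cons, List.prod_cons, List.reverse_cons, List.prod_append,
      List.prod_nil, mul_one]
    calc (L.map Ai).reverse.prod * Ai a * (A a * (L.map A).prod)
        = (L.map Ai).reverse.prod * (Ai a * A a) * (L.map A).prod := by simp only [mul_assoc]
      _ = 1 := by rw [h, mul_one, ih]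

theorem aux_map_mul {S ι : Type*} [CommRing S] [Fintype ι] (d : S → S)
    (hadd : ∀ s t, d (s + t) = d s + d t)
    (hmul : ∀ s t, d (s * t) = s * d t + t * d s) (X Y : Matrix ι ι S) :
    (X * Y).map d = X.map d * Y + X * Y.map d := by
  ext a b
  have hs : ∀ (F : ι → S), d (∑ j, F j) = ∑ j, d (F j) :=
    fun F => map_sum (AddMonoidHom.mk' d hadd) F Finset.univ
  simp only [Matrix.map_apply, Matrix.mul_apply, Matrix.add_apply, hs, hmul,
    ← Finset.sum_add_distrib]
  exact Finset.sum_congr rfl fun j _ => by ring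

/-- (Theorem D.2, Poisson bracket extraction from a multi-factor decomposition, in matrix
form.) Given a `k`-bilinear bracket on `S` which is a derivation in each argument, an
independent family of subspaces `g₁, …, g_p` of matrices over `k` with projection `π_i`
onto the `i`-th summand extended `S`-linearly, and an invertible factorisation
`A = A⁽¹⁾⋯A⁽ᵖ⁾` whose logarithmic derivatives lie in the corresponding blocks, with
conjugation by `A⁽ⁱ⁾` preserving the span of `g_{<i}`, one recovers
`(A⁽ⁱ⁾)⁻¹·{A⁽ⁱ⁾, f} = π_i(P)` where `P = (A⁽¹⁾⋯A⁽ⁱ⁾)⁻¹·{A, f}·(A⁽ⁱ⁺¹⁾⋯A⁽ᵖ⁾)⁻¹`. -/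
theorem poisson_extraction_multi_factor {k S : Type*} [Field k] [CommRing S] [Algebra k S]
    {ι : Type*} [Fintype ι] [DecidableEq ι]
    (br : S → S → S)
    (hbil_l : ∀ (a : k) (s t r : S), br (a • s + t) r = a • br s r + br t r)
    (hbil_r : ∀ (a : k) (s t r : S), br r (a • s + t) = a • br r s + br r t)
    (hder_l : ∀ s t r : S, br (s * t) r = s * br t r + t * br s r)
    (hder_r : ∀ r s t : S, br r (s * t) = s * br r t + t * br r s)
    {p : ℕ} (g : Fin p → Submodule k (Matrix ι ι k))
    (hIndep : iSupIndep g)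
    (i : Fin p)
    (A Ai : Fin p → Matrix ι ι S)
    (hinv : ∀ j : Fin p, A j * Ai j = 1 ∧ Ai j * A j = 1)
    (f : S)
    (pri : Matrix ι ι S →ₗ[S] Matrix ι ι S)
    (hpri_id : ∀ M ∈ matSpan (g i), pri M = M)
    (hpri_lt : ∀ M ∈ matSpan (⨆ j : Fin p, ⨆ _ : j < i, g j), pri M = 0)
    (hpri_gt : ∀ M ∈ matSpan (⨆ j : Fin p, ⨆ _ : i < j, g j), pri M = 0)
    -- (a) the logarithmic derivative of the `i`-th factor lies in the span of `g i`
    (ha : Ai i * (A i).map (fun s => br s f) ∈ matSpan (g i))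
    -- (b) the logarithmic derivative of `B = A⁽¹⁾⋯A⁽ⁱ⁻¹⁾` lies in the span of `g_{<i}`
    (hb : (((List.ofFn Ai).take i.1).reverse).prod
            * (((List.ofFn A).take i.1).prod).map (fun s => br s f)
          ∈ matSpan (⨆ j : Fin p, ⨆ _ : j < i, g j))
    -- (c) the logarithmic derivative of `C = A⁽ⁱ⁺¹⁾⋯A⁽ᵖ⁾` lies in the span of `g_{>i}`
    (hc : (((List.ofFn A).drop (i.1 + 1)).prod).map (fun s => br s f)
            * (((List.ofFn Ai).drop (i.1 + 1)).reverse).prod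
          ∈ matSpan (⨆ j : Fin p, ⨆ _ : i < j, g j))
    -- (d) conjugation by `A⁽ⁱ⁾` preserves the span of `g_{<i}`
    (hd : ∀ W ∈ matSpan (⨆ j : Fin p, ⨆ _ : j < i, g j),
        Ai i * W * A i ∈ matSpan (⨆ j : Fin p, ⨆ _ : j < i, g j)) :
    Ai i * (A i).map (fun s => br s f)
      = pri ((((List.ofFn Ai).take (i.1 + 1)).reverse).prod
              * ((List.ofFn A).prod).map (fun s => br s f)
              * (((List.ofFn Ai).drop (i.1 + 1)).reverse).prod) := by
  have hmm := aux_map_mul (ι := ι) (fun s => br s f)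
    (fun s t => by simpa using hbil_l 1 s t f) (fun s t => hder_l s t f)
  have hB : (((List.ofFn Ai).take i.1).reverse).prod * ((List.ofFn A).take i.1).prod = 1 := by
    rw [List.ofFn_eq_map, List.ofFn_eq_map, ← List.map_take, ← List.map_take]
    exact aux_inv_prod A Ai (fun j => (hinv j).2) _
  have hC : ((List.ofFn A).drop (i.1 + 1)).prod
      * (((List.ofFn Ai).drop (i.1 + 1)).reverse).prod = 1 := by
    rw [List.ofFn_eq_map, List.ofFn_eq_map, ← List.map_drop, ← List.map_drop]
    exact aux_prod_inv A Ai (fun j => (hinv j).1) _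
  have hA : (List.ofFn A).prod = ((List.ofFn A).take i.1).prod * A i
      * ((List.ofFn A).drop (i.1 + 1)).prod := by
    rw [← List.prod_take_mul_prod_drop (List.ofFn A) (i.1 + 1),
      List.take_succ_eq_append_getElem (by simp)]
    simp
  have hAi : (((List.ofFn Ai).take (i.1 + 1)).reverse).prod
      = Ai i * (((List.ofFn Ai).take i.1).reverse).prod := by
    rw [List.take_succ_eq_append_getElem (by simp)]
    simp
  rw [hA, hAi]
  generalize (((List.ofFn Ai).take i.1).reverse).prod = B' at *
  generalize ((List.ofFn A).take i.1).prod = B at *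
  generalize (((List.ofFn Ai).drop (i.1 + 1)).reverse).prod = C' at *
  generalize ((List.ofFn A).drop (i.1 + 1)).prod = C at *
  rw [hmm, hmm]
  have key : Ai i * B' * ((B.map (fun s => br s f) * A i + B * (A i).map (fun s => br s f)) * C
      + B * A i * C.map (fun s => br s f)) * C'
      = Ai i * (B' * B.map (fun s => br s f)) * A i + Ai i * (A i).map (fun s => br s f)
        + C.map (fun s => br s f) * C' := by
    generalize B.map (fun s => br s f) = dB
    generalize C.map (fun s => br s f) = dC
    generalize (A i).map (fun s => br s f) = dA
    calc _ = Ai i * (B' * dB) * A i * (C * C') + Ai i * (B' * B) * dA * (C * C')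
          + Ai i * (B' * B) * A i * (dC * C') := by noncomm_ring
      _ = _ := by rw [hB, hC, mul_one, mul_one, mul_one, (hinv i).2, one_mul]
  rw [key, map_add, map_add, hpri_lt _ (hd _ hb), hpri_gt _ hc, hpri_id _ ha, zero_add, add_zero]
end
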